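/- arXiv:1711.03639 — 3 statements merged into one kernel-verified Lean document; each statement's English description precedes it below -/
import Mathlib

section
/- Let x be a random variable on a probability space (Ω, 𝒜, μ) with 0 ≤ x ≤ 1 almost surely, let m = E[x], and let ε > 0. Then with λ = ln(1+ε), E[ exp( λ·(x − (1+ε)·m) ) ] ≤ 1. -/
open MeasureTheory

/-- The chord bound for `exp` on an interval with endpoints `0` and `t`. -/
theorem exp_mul_le_one_add_mul_exp_sub_one (t : ℝ) {p : ℝ} (hp0 : 0 ≤ p) (hp1 : p ≤ 1) :
    Real.exp (t * p) ≤ 1 + p * (Real.exp t - 1) := by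
  have h := rpow_one_add_le_one_add_mul_self (s := Real.exp t - 1)
    (by linarith [Real.exp_pos t]) hp0 hp1
  rwa [add_sub_cancel, ← Real.exp_mul] at h

/-- The moment generating function of a `[0, 1]`-valued random variable is at most that of a
Poisson variable with the same mean. -/
theorem integral_exp_mul_le_exp_integral_mul {Ω : Type*} {m0 : MeasurableSpace Ω}
    {μ : Measure Ω} [IsProbabilityMeasure μ] {x : Ω → ℝ} (hx : AEMeasurable x μ)
    (h0 : ∀ᵐ ω ∂μ, 0 ≤ x ω) (h1 : ∀ᵐ ω ∂μ, x ω ≤ 1) (t : ℝ) :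
    ∫ ω, Real.exp (t * x ω) ∂μ ≤ Real.exp ((∫ ω, x ω ∂μ) * (Real.exp t - 1)) := by
  have hint : Integrable x μ := Integrable.of_mem_Icc 0 1 hx (h0.and h1)
  have hlin : Integrable (fun ω => x ω * (Real.exp t - 1)) μ := hint.mul_const _
  calc ∫ ω, Real.exp (t * x ω) ∂μ
      ≤ ∫ ω, (1 + x ω * (Real.exp t - 1)) ∂μ := by
        refine integral_mono_of_nonneg (.of_forall fun ω => (Real.exp_pos _).le)
          ((integrable_const 1).add hlin) ?_
        filter_upwards [h0, h1] with ω hω0 hω1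
        exact exp_mul_le_one_add_mul_exp_sub_one t hω0 hω1
    _ = (∫ ω, x ω ∂μ) * (Real.exp t - 1) + 1 := by
        rw [integral_add (integrable_const 1) hlin, integral_mul_const]
        simp [add_comm]
    _ ≤ Real.exp ((∫ ω, x ω ∂μ) * (Real.exp t - 1)) := Real.add_one_le_exp _

/-- **Base case of the upper-tail supermartingale bound, Appendix A.** Let `x` be a random
variable on a probability space with `0 ≤ x ≤ 1` a.s., `m = E[x]` and `ε > 0`.  Then with
`λ = ln(1+ε)`, `E[exp(λ (x - (1+ε) m))] ≤ 1`. -/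
theorem single_variable_upper {Ω : Type*} {m0 : MeasurableSpace Ω}
    (μ : Measure Ω) [IsProbabilityMeasure μ] (x : Ω → ℝ) (hmeas : Measurable x)
    (h0 : ∀ᵐ ω ∂μ, 0 ≤ x ω) (h1 : ∀ᵐ ω ∂μ, x ω ≤ 1) (ε : ℝ) (hε : 0 < ε) :
    ∫ ω, Real.exp (Real.log (1 + ε) * (x ω - (1 + ε) * ∫ ω', x ω' ∂μ)) ∂μ ≤ 1 := by
  have hpos : 0 < 1 + ε := by linarith
  have hm : 0 ≤ ∫ ω, x ω ∂μ := integral_nonneg_of_ae h0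
  have hlog : ε ≤ Real.log (1 + ε) * (1 + ε) := by
    have h := mul_le_mul_of_nonneg_right (Real.one_sub_inv_le_log_of_pos hpos) hpos.le
    rwa [sub_mul, inv_mul_cancel₀ hpos.ne', one_mul, add_sub_cancel_left] at h
  have hmgf := integral_exp_mul_le_exp_integral_mul hmeas.aemeasurable h0 h1 (Real.log (1 + ε))
  rw [Real.exp_log hpos, add_sub_cancel_left] at hmgf
  simp_rw [mul_sub, Real.exp_sub]
  rw [integral_div, div_le_one (Real.exp_pos _)]
  refine hmgf.trans (Real.exp_le_exp.mpr ?_)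
  rw [mul_comm, ← mul_assoc]
  exact mul_le_mul_of_nonneg_right hlog hm
end

section
/- Let x be a random variable on a probability space (Ω, 𝒜, μ) with 0 ≤ x ≤ 1 almost surely, let m = E[x], and let ε ∈ (0,1). Then with λ = −ln(1−ε), E[ exp( λ·((1−ε)·m − x) ) ] ≤ 1. -/
open MeasureTheory

/-- **Base case of the lower-tail supermartingale bound, Appendix A.** Let `x` be a random
variable on a probability space with `0 ≤ x ≤ 1` a.s., `m = E[x]` and `ε ∈ (0,1)`.  Then
with `λ = -ln(1-ε)`, `E[exp(λ ((1-ε) m - x))] ≤ 1`. -/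
theorem single_variable_lower {Ω : Type*} {m0 : MeasurableSpace Ω}
    (μ : Measure Ω) [IsProbabilityMeasure μ] (x : Ω → ℝ) (hmeas : Measurable x)
    (h0 : ∀ᵐ ω ∂μ, 0 ≤ x ω) (h1 : ∀ᵐ ω ∂μ, x ω ≤ 1)
    (ε : ℝ) (hε0 : 0 < ε) (hε1 : ε < 1) :
    ∫ ω, Real.exp ((-Real.log (1 - ε)) * ((1 - ε) * (∫ ω', x ω' ∂μ) - x ω)) ∂μ ≤ 1 := by
  have hpos : 0 < 1 - ε := by linarith
  have hint : Integrable x μ := Integrable.of_mem_Icc 0 1 hmeas.aemeasurable <| by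
    filter_upwards [h0, h1] with ω a b using ⟨a, b⟩
  set m := ∫ ω', x ω' ∂μ
  have hm : 0 ≤ m := integral_nonneg_of_ae h0
  set c := Real.exp (-Real.log (1 - ε) * ((1 - ε) * m))
  have hbound : ∀ᵐ ω ∂μ,
      Real.exp (-Real.log (1 - ε) * ((1 - ε) * m - x ω)) ≤ c * (1 - ε * x ω) := by
    filter_upwards [h0, h1] with ω a b
    have hsplit : Real.exp (-Real.log (1 - ε) * ((1 - ε) * m - x ω)) = c * (1 - ε) ^ x ω := by
      rw [Real.rpow_def_of_pos hpos, ← Real.exp_add]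
      ring_nf
    have hbern := rpow_one_add_le_one_add_mul_self (s := -ε) (by linarith) a b
    rw [← sub_eq_add_neg] at hbern
    rw [hsplit]
    gcongr
    linarith
  have hlog : -Real.log (1 - ε) * (1 - ε) ≤ ε := by
    have h := mul_le_mul_of_nonneg_right (Real.one_sub_inv_le_log_of_pos hpos) hpos.le
    rw [sub_mul, inv_mul_cancel₀ hpos.ne'] at h
    linarith
  calc
    _ ≤ ∫ ω, c * (1 - ε * x ω) ∂μ :=
      integral_mono_of_nonneg (.of_forall fun _ => (Real.exp_pos _).le)
        (((integrable_const 1).sub (hint.const_mul ε)).const_mul c) hbound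
    _ = c * (1 - ε * m) := by
      rw [integral_const_mul, integral_sub (integrable_const 1) (hint.const_mul ε),
        integral_const_mul]
      simp [m]
    _ ≤ c * Real.exp (-(ε * m)) := by
      gcongr
      exact Real.one_sub_le_exp_neg _
    _ ≤ 1 := by
      rw [← Real.exp_add, Real.exp_le_one_iff]
      linarith [mul_le_mul_of_nonneg_right hlog hm]
end

section
/- Let L̂, L★, Ψ be nonnegative real numbers and let a ∈ (0,1). If L̂ − L★ ≤ Ψ^{1−a} · L̂^{a}, then L̂ − L★ ≤ (1/(1−a)) · (L★)^{a} · Ψ^{1−a} + Ψ. -/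
/-- **Self-bounding step of the doubling trick (Lemma 3.5, Appendix A).**
Let `L̂, L★, Ψ ≥ 0` and `a ∈ (0,1)`.  If `L̂ - L★ ≤ Ψ^(1-a) L̂^a`, then
`L̂ - L★ ≤ (1/(1-a)) (L★)^a Ψ^(1-a) + Ψ`. -/
theorem self_bounding_regret (Lhat Lstar Ψ : ℝ) (hLhat : 0 ≤ Lhat) (hLstar : 0 ≤ Lstar)
    (hΨ : 0 ≤ Ψ) (a : ℝ) (ha0 : 0 < a) (ha1 : a < 1)
    (h : Lhat - Lstar ≤ Ψ ^ (1 - a) * Lhat ^ a) :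
    Lhat - Lstar ≤ (1 / (1 - a)) * Lstar ^ a * Ψ ^ (1 - a) + Ψ := by
  have ha : 0 < 1 - a := by linarith
  rcases le_total Lhat Lstar with hle | hle
  · have : 0 ≤ (1 / (1 - a)) * Lstar ^ a * Ψ ^ (1 - a) + Ψ := by positivity
    linarith
  have hD : 0 ≤ Lhat - Lstar := sub_nonneg.2 hle
  have hsub : Lhat ^ a ≤ Lstar ^ a + (Lhat - Lstar) ^ a := by
    simpa using Real.rpow_add_le_add_rpow hLstar hD ha0.le ha1.le
  have hyoung : Ψ ^ (1 - a) * (Lhat - Lstar) ^ a ≤ (1 - a) * Ψ + a * (Lhat - Lstar) :=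
    Real.geom_mean_le_arith_mean2_weighted ha.le ha0.le hΨ hD (by ring)
  have hmul := mul_le_mul_of_nonneg_left hsub (Real.rpow_nonneg hΨ (1 - a))
  have hscaled : (1 - a) * (Lhat - Lstar) ≤ Lstar ^ a * Ψ ^ (1 - a) + (1 - a) * Ψ := by
    linarith
  refine le_of_mul_le_mul_left (hscaled.trans_eq ?_) ha
  field_simp
end
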